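/- Let F be a p-adic field, n ≥ 1, and let GL_{2n}^{fix} ⊆ GL_{2n}(F) be the subgroup of matrices whose first column is (z,0,…,0)^t and last column is (0,…,0,z^{-1})^t for some z ∈ F^×. Let E = diag(1,−1,…,1,−1). Then the orbit of E under conjugation by GL_{2n}^{fix} consists exactly of the matrices of the block form [[1, x, 0],[0, A, 0],[0, y, −1]], where A ∈ GL_{2(n−1)}(F) is an involution with characteristic polynomial (λ²−1)^{n−1}, x, y are row vectors of size 2(n−1), x(A + I) = 0 and y(A − I) = 0. In particular this orbit is closed in GL_{2n}(F). -/

import Mathlib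

open MeasureTheory

/-- Two finite families with the same multiset of values differ by a bijection of the indices. -/
theorem exists_equiv_comp_eq_of_map_univ_eq {ι κ α : Type*} [Fintype ι] [Fintype κ]
    {f : ι → α} {g : κ → α}
    (h : (Finset.univ.val.map f : Multiset α) = Finset.univ.val.map g) :
    ∃ e : ι ≃ κ, ∀ i, g (e i) = f i := by
  classical
  have hcard : ∀ a, Nonempty ({i // f i = a} ≃ {j // g j = a}) := by
    intro a
    rw [← Fintype.card_eq, Fintype.card_subtype, Fintype.card_subtype]
    have := congrArg (Multiset.count a) h
    simp only [Multiset.count_map] at this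
    simpa only [Finset.card_def, Finset.filter_val, eq_comm] using this
  let E : ∀ a, {i // f i = a} ≃ {j // g j = a} := fun a => (hcard a).some
  refine ⟨(Equiv.sigmaFiberEquiv f).symm.trans
    ((Equiv.sigmaCongrRight E).trans (Equiv.sigmaFiberEquiv g)), fun i => ?_⟩
  exact (E (f i) ⟨i, rfl⟩).2

namespace Matrix

open Polynomial

section Involution

variable {K ι : Type*} [Field K] [Fintype ι] [DecidableEq ι]

theorem roots_charpoly_diagonal (d : ι → K) :
    (diagonal d).charpoly.roots = Finset.univ.val.map d := by
  rw [charpoly_diagonal, ← roots_multiset_prod_X_sub_C (Finset.univ.val.map d), Multiset.map_map]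
  rfl

/-- Over a field in which `2` is invertible, an involution is diagonalizable. -/
theorem exists_basis_of_mul_self_eq_one (h2 : (2 : K) ≠ 0) {A : Matrix ι ι K} (hA : A * A = 1) :
    ∃ (κ : Type) (_ : Fintype κ) (_ : DecidableEq κ) (b : Module.Basis κ K (ι → K)) (c : κ → K),
      ∀ k, A *ᵥ b k = c k • b k := by
  let p : Submodule K (ι → K) := LinearMap.ker (toLin' (A - 1))
  let q : Submodule K (ι → K) := LinearMap.ker (toLin' (A + 1))
  have hp : ∀ v, v ∈ p ↔ A *ᵥ v = v := fun v => by
    simp [p, sub_eq_zero]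
  have hq : ∀ v, v ∈ q ↔ A *ᵥ v = -v := fun v => by
    simp [q, add_eq_zero_iff_eq_neg]
  have hpq : IsCompl p q := by
    constructor
    · rw [Submodule.disjoint_def]
      intro v hv hv'
      rw [hp] at hv
      rw [hq, hv] at hv'
      have : (2 : K) • v = 0 := by rw [two_smul]; nth_rewrite 1 [hv']; simp
      exact (smul_eq_zero.1 this).resolve_left h2
    · rw [codisjoint_iff, eq_top_iff]
      intro v _
      have hAA : A *ᵥ (A *ᵥ v) = v := by rw [mulVec_mulVec, hA, one_mulVec]
      have h1 : (2 : K)⁻¹ • (v + A *ᵥ v) ∈ p := by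
        rw [hp, mulVec_smul, mulVec_add, hAA, add_comm]
      have h3 : (2 : K)⁻¹ • (v - A *ᵥ v) ∈ q := by
        rw [hq, mulVec_smul, mulVec_sub, hAA, ← smul_neg, neg_sub]
      have := Submodule.add_mem_sup h1 h3
      rwa [← smul_add, add_add_sub_cancel, ← two_smul K, smul_smul, inv_mul_cancel₀ h2,
        one_smul] at this
  refine ⟨_, inferInstance, inferInstance,
    ((Module.finBasis K p).prod (Module.finBasis K q)).map (p.prodEquivOfIsCompl q hpq),
    Sum.elim (fun _ => 1) (fun _ => -1), ?_⟩
  rintro (k | k)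
  · simpa using (hp _).1 (Module.finBasis K p k).2
  · simpa using (hq _).1 (Module.finBasis K q k).2

/-- Over a field in which `2` is invertible, an involution is similar to any diagonal matrix with
the same characteristic polynomial. -/
theorem exists_isUnit_mul_diagonal_of_mul_self_eq_one (h2 : (2 : K) ≠ 0) {A : Matrix ι ι K}
    (hA : A * A = 1) {d : ι → K} (hd : A.charpoly = (diagonal d).charpoly) :
    ∃ h : Matrix ι ι K, IsUnit h ∧ A * h = h * diagonal d := by
  obtain ⟨κ, _, _, b, c, hbc⟩ := exists_basis_of_mul_self_eq_one h2 hA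
  have hdiag : LinearMap.toMatrix b b (toLin' A) = diagonal c := by
    ext i j
    rw [LinearMap.toMatrix_apply, toLin'_apply, hbc, map_smul, Module.Basis.repr_self]
    simp [diagonal_apply, Finsupp.single_apply]
    grind
  have hc : (diagonal d).charpoly = (diagonal c).charpoly := by
    rw [← hd, ← hdiag, LinearMap.charpoly_toMatrix, charpoly_toLin']
  obtain ⟨e, he⟩ := exists_equiv_comp_eq_of_map_univ_eq
    ((roots_charpoly_diagonal d).symm.trans (hc ▸ roots_charpoly_diagonal c))
  let b' := b.reindex e.symm
  refine ⟨of fun i k => b' k i, ?_, ?_⟩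
  · have : (of fun i k => b' k i) = (Pi.basisFun K ι).toMatrix b' := by
      ext i k; simp [Module.Basis.toMatrix_apply]
    rw [this]
    let := (Pi.basisFun K ι).invertibleToMatrix b'
    exact isUnit_of_invertible _
  · ext i k
    have := congrFun (hbc (e k)) i
    rw [mul_diagonal]
    simpa [b', mul_apply, mulVec, dotProduct, he, mul_comm] using this

end Involution

section Bordered

variable {K ι κ : Type*} [CommRing K]

/-- The matrix `[[a, x, 0], [0, A, 0], [0, y, b]]`, with rows and columns relabelled by `e`. -/
def bordered (e : (Unit ⊕ ι) ⊕ Unit ≃ κ) (a : K) (x : ι → K) (A : Matrix ι ι K) (y : ι → K)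
    (b : K) : Matrix κ κ K :=
  (fromBlocks (fromBlocks (of fun _ _ => a) (replicateRow Unit x) 0 A) 0
    (fromCols 0 (replicateRow Unit y)) (of fun _ _ => b)).submatrix e.symm e.symm

variable (e : (Unit ⊕ ι) ⊕ Unit ≃ κ)

theorem eq_bordered_iff [DecidableEq κ] (M : Matrix κ κ K) (a : K) (x : ι → K) (A : Matrix ι ι K) (y : ι → K)
    (b : K) :
    M = bordered e a x A y b ↔
      (∀ i, M i (e (.inl (.inl ()))) = if i = e (.inl (.inl ())) then a else 0) ∧
      (∀ i, M i (e (.inr ())) = if i = e (.inr ()) then b else 0) ∧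
      (fun k => M (e (.inl (.inl ()))) (e (.inl (.inr k)))) = x ∧
      M.submatrix (fun k => e (.inl (.inr k))) (fun k => e (.inl (.inr k))) = A ∧
      (fun k => M (e (.inr ())) (e (.inl (.inr k)))) = y := by
  constructor
  · rintro rfl
    refine ⟨fun i => ?_, fun i => ?_, ?_, ?_, ?_⟩
    · obtain ⟨i, rfl⟩ := e.surjective i
      rcases i with (i | i) | i <;> simp [bordered]
    · obtain ⟨i, rfl⟩ := e.surjective i
      rcases i with (i | i) | i <;> simp [bordered]
    · ext; simp [bordered]
    · ext; simp [bordered]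
    · ext; simp [bordered]
  · rintro ⟨h0, h1, rfl, rfl, rfl⟩
    ext i j
    obtain ⟨i, rfl⟩ := e.surjective i
    obtain ⟨j, rfl⟩ := e.surjective j
    rcases j with (j | j) | j
    · rw [h0]; rcases i with (i | i) | i <;> simp [bordered]
    · rcases i with (i | i) | i <;> simp [bordered]
    · rw [h1]; rcases i with (i | i) | i <;> simp [bordered]

theorem bordered_mul [Fintype ι] [Fintype κ] (a a' b b' : K) (x x' y y' : ι → K) (A A' : Matrix ι ι K) :
    bordered e a x A y b * bordered e a' x' A' y' b' =
      bordered e (a * a') (a • x' + x ᵥ* A') (A * A') (y ᵥ* A' + b • y') (b * b') := by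
  rw [bordered, bordered, bordered, submatrix_mul_equiv, fromBlocks_multiply]
  congr 1
  ext i j
  rcases i with (i | i) | i <;> rcases j with (j | j) | j <;>
    simp [mul_apply, vecMul, dotProduct, fromBlocks, fromCols]

theorem bordered_one [DecidableEq ι] [DecidableEq κ] : bordered e (1 : K) 0 (1 : Matrix ι ι K) 0 1 = 1 := by
  symm
  rw [eq_bordered_iff]
  refine ⟨fun i => by simp [one_apply], fun i => by simp [one_apply], ?_, ?_, ?_⟩ <;> ext <;>
    simp [one_apply]

theorem diagonal_eq_bordered [DecidableEq ι] [DecidableEq κ] (d : κ → K) :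
    diagonal d = bordered e (d (e (.inl (.inl ())))) 0
      (diagonal fun k => d (e (.inl (.inr k)))) 0 (d (e (.inr ()))) := by
  rw [eq_bordered_iff]
  refine ⟨fun i => ?_, fun i => ?_, ?_, ?_, ?_⟩
  · by_cases h : i = e (.inl (.inl ())) <;> simp [h]
  · by_cases h : i = e (.inr ()) <;> simp [h]
  all_goals ext; simp [diagonal_apply]

theorem bordered_inj {a a' b b' : K} {x x' y y' : ι → K} {A A' : Matrix ι ι K}
    (h : bordered e a x A y b = bordered e a' x' A' y' b') :
    x = x' ∧ A = A' ∧ y = y' := by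
  classical
  have h1 := (eq_bordered_iff e _ _ _ _ _ _).1 h
  have h2 := (eq_bordered_iff e _ _ _ _ _ _).1 (rfl : bordered e a x A y b = _)
  exact ⟨h2.2.2.1.symm.trans h1.2.2.1, h2.2.2.2.1.symm.trans h1.2.2.2.1,
    h2.2.2.2.2.symm.trans h1.2.2.2.2⟩

theorem det_bordered [Fintype ι] [DecidableEq ι] [Fintype κ] [DecidableEq κ] (a b : K) (x y : ι → K) (A : Matrix ι ι K) :
    (bordered e a x A y b).det = a * A.det * b := by
  rw [bordered, det_submatrix_equiv_self, det_fromBlocks_zero₁₂, det_fromBlocks_zero₂₁]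
  simp

end Bordered

section Orbit

variable {K ι κ : Type*} [Field K] [Fintype ι] [DecidableEq ι] [Fintype κ] [DecidableEq κ]
  (e : (Unit ⊕ ι) ⊕ Unit ≃ κ)

theorem exists_conj_eq_iff (h2 : (2 : K) ≠ 0) {E : Matrix κ κ K} {d : ι → K}
    (hd : ∀ i, d i * d i = 1) (hE : E = bordered e 1 0 (diagonal d) 0 (-1)) (M : Matrix κ κ K) :
    (∃ g : GL κ K, (∃ z : Kˣ, ∃ u h v,
        (g : Matrix κ κ K) = bordered e (z : K) u h v ((z⁻¹ : Kˣ) : K)) ∧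
        M = (g : Matrix κ κ K) * E * ((g⁻¹ : GL κ K) : Matrix κ κ K)) ↔
      ∃ x A y, M = bordered e 1 x A y (-1) ∧ A * A = 1 ∧ A.charpoly = (diagonal d).charpoly ∧
        x ᵥ* (A + 1) = 0 ∧ y ᵥ* (A - 1) = 0 := by
  have hdd : diagonal d * diagonal d = 1 := by simp [hd]
  constructor
  · rintro ⟨g, ⟨z, u, h, v, hg⟩, rfl⟩
    have hdet : IsUnit h.det := by
      have := (isUnit_iff_isUnit_det _).1 g.isUnit
      rw [hg, det_bordered] at this
      exact isUnit_of_mul_isUnit_right (isUnit_of_mul_isUnit_left this)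
    have hh : h * h⁻¹ = 1 := mul_nonsing_inv h hdet
    have hinv : ((g⁻¹ : GL κ K) : Matrix κ κ K) = bordered e ((z⁻¹ : Kˣ) : K)
        (-((z⁻¹ : Kˣ) : K) • (u ᵥ* h⁻¹)) h⁻¹ (-(z : K) • (v ᵥ* h⁻¹)) (z : K) := by
      rw [coe_units_inv]
      apply inv_eq_right_inv
      rw [hg, bordered_mul, hh, ← bordered_one e]
      congr 1 <;> simp [smul_smul]
    have hM : ∃ x y, (g : Matrix κ κ K) * E * ((g⁻¹ : GL κ K) : Matrix κ κ K) =
        bordered e 1 x (h * diagonal d * h⁻¹) y (-1) := by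
      rw [hinv, hg, hE, bordered_mul, bordered_mul]
      simp only [smul_zero, zero_add, add_zero, mul_one, mul_neg, neg_mul, Units.mul_inv,
        Units.inv_mul]
      exact ⟨_, _, rfl⟩
    obtain ⟨x, y, hM⟩ := hM
    have hEE : E * E = 1 := by
      rw [hE, bordered_mul, hdd, ← bordered_one e]
      congr 1 <;> simp
    have hMM : ((g : Matrix κ κ K) * E * ((g⁻¹ : GL κ K) : Matrix κ κ K)) *
        ((g : Matrix κ κ K) * E * ((g⁻¹ : GL κ K) : Matrix κ κ K)) = 1 := by
      have h1 : ((g⁻¹ : GL κ K) : Matrix κ κ K) * (g : Matrix κ κ K) = 1 := by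
        rw [← Units.val_mul]; simp
      have h3 : (g : Matrix κ κ K) * ((g⁻¹ : GL κ K) : Matrix κ κ K) = 1 := by
        rw [← Units.val_mul]; simp
      calc _ = (g : Matrix κ κ K) * (E * (((g⁻¹ : GL κ K) : Matrix κ κ K) *
            (g : Matrix κ κ K)) * E) * ((g⁻¹ : GL κ K) : Matrix κ κ K) := by
              simp only [Matrix.mul_assoc]
        _ = 1 := by rw [h1, Matrix.mul_one, hEE, Matrix.mul_one, h3]
    rw [hM, bordered_mul, ← bordered_one e] at hMM
    obtain ⟨hx, hA, hy⟩ := bordered_inj e hMM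
    refine ⟨x, _, y, hM, hA, ?_, ?_, ?_⟩
    · rw [charpoly_mul_comm, ← Matrix.mul_assoc, nonsing_inv_mul h hdet, Matrix.one_mul]
    · rw [vecMul_add, vecMul_one, add_comm]; simpa using hx
    · rw [vecMul_sub, vecMul_one]; simpa [sub_eq_add_neg] using hy
  · rintro ⟨x, A, y, rfl, hA, hc, hx, hy⟩
    obtain ⟨h, hu, hAh⟩ := exists_isUnit_mul_diagonal_of_mul_self_eq_one h2 hA hc
    have hx' : x ᵥ* A = -x := by
      rwa [vecMul_add, vecMul_one, add_eq_zero_iff_eq_neg] at hx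
    have hy' : y ᵥ* A = y := by rwa [vecMul_sub, vecMul_one, sub_eq_zero] at hy
    let G := bordered e 1 (-(2 : K)⁻¹ • (x ᵥ* h)) h ((2 : K)⁻¹ • (y ᵥ* h)) 1
    have hG : IsUnit G := by
      rw [isUnit_iff_isUnit_det, det_bordered]
      simpa using (isUnit_iff_isUnit_det _).1 hu
    obtain ⟨g, hg⟩ := hG
    refine ⟨g, ⟨1, _, _, _, by simpa [G] using hg⟩, ?_⟩
    have hMg : bordered e 1 x A y (-1) * (g : Matrix κ κ K) = (g : Matrix κ κ K) * E := by
      rw [hg, hE, bordered_mul, bordered_mul, hAh]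
      have hxd : (x ᵥ* h) ᵥ* diagonal d = -(x ᵥ* h) := by
        rw [vecMul_vecMul, ← hAh, ← vecMul_vecMul, hx', neg_vecMul]
      have hyd : (y ᵥ* h) ᵥ* diagonal d = y ᵥ* h := by
        rw [vecMul_vecMul, ← hAh, ← vecMul_vecMul, hy']
      have half : (2 : K)⁻¹ + (2 : K)⁻¹ = 1 := by
        rw [← two_mul, mul_inv_cancel₀ h2]
      congr 1
      · rw [smul_vecMul, hxd]
        ext i
        simp
        linear_combination (-(x ᵥ* h) i) * half
      · rw [smul_vecMul, hyd]
        ext i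
        simp
        linear_combination (-(y ᵥ* h) i) * half
      · simp
    rw [← hMg, Matrix.mul_assoc, ← Units.val_mul]
    simp

end Orbit

theorem isClosed_setOf_charpoly_eq {K ι : Type*} [Field K] [Infinite K] [TopologicalSpace K]
    [IsTopologicalRing K] [T1Space K] [Fintype ι] [DecidableEq ι] (q : K[X]) :
    IsClosed {A : Matrix ι ι K | A.charpoly = q} := by
  have : {A : Matrix ι ι K | A.charpoly = q} =
      ⋂ t : K, {A | (scalar ι t - A).det = q.eval t} := by
    ext A
    simp only [Set.mem_ofPred_eq, Set.mem_iInter, ← eval_charpoly]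
    exact ⟨fun h t => by rw [h], Polynomial.funext⟩
  rw [this]
  refine isClosed_iInter fun t => ?_
  exact isClosed_singleton.preimage ((continuous_const.sub continuous_id).matrix_det)

end Matrix

/-- The indices `0, 1, …, m + 1` split as the first one, the middle ones and the last one. -/
noncomputable def finBorderEquiv {m N : ℕ} (h : N = m + 2) : (Unit ⊕ Fin m) ⊕ Unit ≃ Fin N :=
  Equiv.ofBijective
    (Sum.elim (Sum.elim (fun _ => ⟨0, by omega⟩) (fun k => ⟨k.1 + 1, by have := k.2; omega⟩))
      (fun _ => ⟨N - 1, by omega⟩)) <| by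
    constructor
    · rintro ((i | i) | i) ((j | j) | j) h <;> simp [Fin.ext_iff] at h ⊢ <;> omega
    · intro i
      by_cases h0 : i.1 = 0
      · exact ⟨.inl (.inl ()), Fin.ext (by simp [h0])⟩
      by_cases h1 : i.1 = N - 1
      · exact ⟨.inr (), Fin.ext (by simp [h1])⟩
      · exact ⟨.inl (.inr ⟨i.1 - 1, by omega⟩), Fin.ext (by simp; omega)⟩

theorem Polynomial.prod_X_sub_C_alternating {K : Type*} [CommRing K] (m : ℕ) :
    ∏ k ∈ Finset.range (2*m), (X - C (if (k + 1) % 2 = 0 then (1 : K) else -1)) =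
      (X ^ 2 - 1) ^ m := by
  induction m with
  | zero => simp
  | succ m ih =>
    rw [Nat.mul_succ, Finset.prod_range_succ, Finset.prod_range_succ, ih,
      if_neg (by omega), if_pos (by omega), pow_succ]
    simp
    ring

/-- **The conjugation orbit of `E` under `GL_{2n}^{fix}` is closed** (Lemma 9.2 of the
paper).  Let `GL_{2n}^{fix} ⊆ GL_{2n}(F)` consist of the matrices whose first column is
`(z,0,…,0)^t` and whose last column is `(0,…,0,z⁻¹)^t` for some `z ∈ F^×`, and let
`E = diag(1,−1,…,1,−1)`.  Then the conjugation orbit `{g E g⁻¹ : g ∈ GL_{2n}^{fix}}`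
consists exactly of the matrices of block form `[[1,x,0],[0,A,0],[0,y,−1]]` with
`A ∈ GL_{2(n−1)}` an involution with characteristic polynomial `(λ²−1)^{n−1}`,
`x(A+I) = 0` and `y(A−I) = 0`; in particular the orbit is a closed subset of the space
of matrices (hence closed in `GL_{2n}(F)`). -/
theorem stmt7 (p : ℕ) [Fact p.Prime] (n : ℕ) (hn : 1 ≤ n) :
    ({M : Matrix (Fin (2*n)) (Fin (2*n)) ℚ_[p] |
        ∃ g : GL (Fin (2*n)) ℚ_[p],
          (∃ z : ℚ_[p]ˣ,
            (∀ i : Fin (2*n), (g : Matrix (Fin (2*n)) (Fin (2*n)) ℚ_[p]) i ⟨0, by omega⟩ =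
              if i = ⟨0, by omega⟩ then (z : ℚ_[p]) else 0) ∧
            (∀ i : Fin (2*n), (g : Matrix (Fin (2*n)) (Fin (2*n)) ℚ_[p]) i ⟨2*n-1, by omega⟩ =
              if i = ⟨2*n-1, by omega⟩ then ((z⁻¹ : ℚ_[p]ˣ) : ℚ_[p]) else 0)) ∧
          M = (g : Matrix (Fin (2*n)) (Fin (2*n)) ℚ_[p]) *
                Matrix.diagonal (fun i : Fin (2*n) => if (i : ℕ) % 2 = 0 then (1 : ℚ_[p]) else -1) *
                ((g⁻¹ : GL (Fin (2*n)) ℚ_[p]) : Matrix (Fin (2*n)) (Fin (2*n)) ℚ_[p])} =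
      {M : Matrix (Fin (2*n)) (Fin (2*n)) ℚ_[p] |
        M ⟨0, by omega⟩ ⟨0, by omega⟩ = 1 ∧
        M ⟨2*n-1, by omega⟩ ⟨2*n-1, by omega⟩ = -1 ∧
        (∀ i : Fin (2*n), i ≠ ⟨0, by omega⟩ → M i ⟨0, by omega⟩ = 0) ∧
        (∀ i : Fin (2*n), i ≠ ⟨2*n-1, by omega⟩ → M i ⟨2*n-1, by omega⟩ = 0) ∧
        (M.submatrix (fun k : Fin (2*n-2) => (⟨k.1 + 1, by have := k.2; omega⟩ : Fin (2*n)))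
              (fun k : Fin (2*n-2) => (⟨k.1 + 1, by have := k.2; omega⟩ : Fin (2*n)))) *
          (M.submatrix (fun k : Fin (2*n-2) => (⟨k.1 + 1, by have := k.2; omega⟩ : Fin (2*n)))
              (fun k : Fin (2*n-2) => (⟨k.1 + 1, by have := k.2; omega⟩ : Fin (2*n)))) = 1 ∧
        (M.submatrix (fun k : Fin (2*n-2) => (⟨k.1 + 1, by have := k.2; omega⟩ : Fin (2*n)))
              (fun k : Fin (2*n-2) => (⟨k.1 + 1, by have := k.2; omega⟩ : Fin (2*n)))).charpoly =
          (Polynomial.X ^ 2 - 1) ^ (n - 1) ∧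
        Matrix.vecMul (fun k : Fin (2*n-2) => M ⟨0, by omega⟩ ⟨k.1 + 1, by have := k.2; omega⟩)
          ((M.submatrix (fun k : Fin (2*n-2) => (⟨k.1 + 1, by have := k.2; omega⟩ : Fin (2*n)))
              (fun k : Fin (2*n-2) => (⟨k.1 + 1, by have := k.2; omega⟩ : Fin (2*n)))) + 1) = 0 ∧
        Matrix.vecMul (fun k : Fin (2*n-2) => M ⟨2*n-1, by omega⟩ ⟨k.1 + 1, by have := k.2; omega⟩)
          ((M.submatrix (fun k : Fin (2*n-2) => (⟨k.1 + 1, by have := k.2; omega⟩ : Fin (2*n)))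
              (fun k : Fin (2*n-2) => (⟨k.1 + 1, by have := k.2; omega⟩ : Fin (2*n)))) - 1) = 0}) ∧
    IsClosed {M : Matrix (Fin (2*n)) (Fin (2*n)) ℚ_[p] |
        ∃ g : GL (Fin (2*n)) ℚ_[p],
          (∃ z : ℚ_[p]ˣ,
            (∀ i : Fin (2*n), (g : Matrix (Fin (2*n)) (Fin (2*n)) ℚ_[p]) i ⟨0, by omega⟩ =
              if i = ⟨0, by omega⟩ then (z : ℚ_[p]) else 0) ∧
            (∀ i : Fin (2*n), (g : Matrix (Fin (2*n)) (Fin (2*n)) ℚ_[p]) i ⟨2*n-1, by omega⟩ =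
              if i = ⟨2*n-1, by omega⟩ then ((z⁻¹ : ℚ_[p]ˣ) : ℚ_[p]) else 0)) ∧
          M = (g : Matrix (Fin (2*n)) (Fin (2*n)) ℚ_[p]) *
                Matrix.diagonal (fun i : Fin (2*n) => if (i : ℕ) % 2 = 0 then (1 : ℚ_[p]) else -1) *
                ((g⁻¹ : GL (Fin (2*n)) ℚ_[p]) : Matrix (Fin (2*n)) (Fin (2*n)) ℚ_[p])} := by
  have h2 : (2 : ℚ_[p]) ≠ 0 := two_ne_zero
  let e := finBorderEquiv (m := 2*n-2) (N := 2*n) (by omega)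
  let d : Fin (2*n-2) → ℚ_[p] := fun k => if (k.1 + 1) % 2 = 0 then 1 else -1
  have hd : ∀ k, d k * d k = 1 := fun k => by
    by_cases h : (k.1 + 1) % 2 = 0 <;> simp [d, h]
  have hE : Matrix.diagonal
      (fun i : Fin (2*n) => if (i : ℕ) % 2 = 0 then (1 : ℚ_[p]) else -1) =
        Matrix.bordered e 1 0 (Matrix.diagonal d) 0 (-1) := by
    rw [Matrix.diagonal_eq_bordered e]
    have hlast : (2*n-1) % 2 ≠ 0 := by omega
    exact congrArg (Matrix.bordered e 1 0 (Matrix.diagonal d) 0) (if_neg hlast)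
  have hchar : (Matrix.diagonal d).charpoly = (Polynomial.X ^ 2 - 1) ^ (n - 1) := by
    rw [Matrix.charpoly_diagonal, ← Polynomial.prod_X_sub_C_alternating, Nat.mul_sub,
      ← Fin.prod_univ_eq_prod_range
        (fun k => Polynomial.X - Polynomial.C (if (k + 1) % 2 = 0 then (1 : ℚ_[p]) else -1))]
  refine (and_iff_left_of_imp fun hset => ?_).2 ?_
  · rw [hset]
    have hentry : ∀ i j, Continuous fun M : Matrix (Fin (2*n)) (Fin (2*n)) ℚ_[p] => M i j :=
      fun i j => continuous_id.matrix_elem i j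
    have hcol : ∀ j, IsClosed
        {M : Matrix (Fin (2*n)) (Fin (2*n)) ℚ_[p] | ∀ i, i ≠ j → M i j = 0} := fun j => by
      simp only [Set.ofPred_forall]
      exact isClosed_iInter fun i => isClosed_iInter fun _ =>
        isClosed_eq (hentry _ _) continuous_const
    have hrow : ∀ i, Continuous fun (M : Matrix (Fin (2*n)) (Fin (2*n)) ℚ_[p])
        (k : Fin (2*n-2)) => M i ⟨k.1 + 1, by have := k.2; omega⟩ :=
      fun i => continuous_pi fun k => hentry _ _
    have hmid : Continuous fun M : Matrix (Fin (2*n)) (Fin (2*n)) ℚ_[p] =>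
        M.submatrix (fun k : Fin (2*n-2) => (⟨k.1 + 1, by have := k.2; omega⟩ : Fin (2*n)))
          (fun k : Fin (2*n-2) => (⟨k.1 + 1, by have := k.2; omega⟩ : Fin (2*n))) :=
      continuous_id.matrix_submatrix _ _
    refine (isClosed_eq (hentry _ _) continuous_const).inter <|
      (isClosed_eq (hentry _ _) continuous_const).inter <| (hcol _).inter <|
      (hcol _).inter <| (isClosed_eq (hmid.matrix_mul hmid) continuous_const).inter <|
      ((Matrix.isClosed_setOf_charpoly_eq _).preimage hmid).inter <|
      (isClosed_eq ((hrow _).matrix_vecMul (hmid.add continuous_const)) continuous_const).inter <|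
      isClosed_eq ((hrow _).matrix_vecMul (hmid.sub continuous_const)) continuous_const
  · ext M
    refine Iff.trans ?_ ((Matrix.exists_conj_eq_iff e h2 hd hE M).trans ?_)
    · refine exists_congr fun g => and_congr_left' (exists_congr fun z => ?_)
      constructor
      · rintro ⟨h0, h1⟩
        exact ⟨_, _, _, (Matrix.eq_bordered_iff e _ _ _ _ _ _).2 ⟨h0, h1, rfl, rfl, rfl⟩⟩
      · rintro ⟨u, h, v, hg⟩
        obtain ⟨h0, h1, -⟩ := (Matrix.eq_bordered_iff e _ _ _ _ _ _).1 hg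
        exact ⟨h0, h1⟩
    · rw [hchar]
      constructor
      · rintro ⟨x, A, y, hM, hA, hc, hx, hy⟩
        obtain ⟨h0, h1, rfl, rfl, rfl⟩ := (Matrix.eq_bordered_iff e _ _ _ _ _ _).1 hM
        exact ⟨(h0 _).trans (if_pos rfl), (h1 _).trans (if_pos rfl),
          fun i hi => (h0 i).trans (if_neg hi), fun i hi => (h1 i).trans (if_neg hi),
          hA, hc, hx, hy⟩
      · rintro ⟨h00, h11, h0, h1, hA, hc, hx, hy⟩
        refine ⟨_, _, _, (Matrix.eq_bordered_iff e _ _ _ _ _ _).2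
          ⟨fun i => ?_, fun i => ?_, rfl, rfl, rfl⟩, hA, hc, hx, hy⟩
        · split_ifs with hi
          · rw [hi]; exact h00
          · exact h0 i hi
        · split_ifs with hi
          · rw [hi]; exact h11
          · exact h1 i hi
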